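/- arXiv:math/0301358 — 2 statements merged into one kernel-verified Lean document; each statement's English description precedes it below -/
import Mathlib

section
/- Let n ≥ 2 and let M be a symmetric n×n matrix with integer entries whose real cast is negative definite, and whose off-diagonal entries are nonnegative (M i j ≥ 0 for i ≠ j). Then for any two indices i ≠ j there exists a vector m ∈ ℤⁿ with m k ≥ 0 for all k, (M·m) k ≤ 0 for all k, and m i ≠ m j. -/
open Matrix

/-- If the off-diagonal entries of a negative definite matrix `M` are nonnegative, then every
vector `v` with `M *ᵥ v ≤ 0` is nonnegative. -/
theorem nonneg_of_mulVec_nonpos_s8 {ι R : Type*} [Fintype ι] [CommRing R] [LinearOrder R]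
    [IsStrictOrderedRing R] {M : Matrix ι ι R} (hneg : ∀ x : ι → R, x ≠ 0 → x ⬝ᵥ M *ᵥ x < 0)
    (hoff : ∀ i j, i ≠ j → 0 ≤ M i j) {v : ι → R} (hv : ∀ k, (M *ᵥ v) k ≤ 0) (k : ι) :
    0 ≤ v k := by
  set y : ι → R := fun k => max (-v k) 0 with hy
  have hy0 : ∀ k, 0 ≤ y k := fun k => le_max_right _ _
  have hvy : ∀ k, 0 ≤ v k + y k := fun k => by
    linarith [le_max_left (-v k) 0]
  have h_diag : ∀ k, y k * (v k + y k) = 0 := fun k => by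
    rcases le_total (-v k) 0 with h | h <;> simp [hy, h]
  have h_sum : 0 ≤ y ⬝ᵥ M *ᵥ (v + y) := by
    simp only [dotProduct, mulVec, Finset.mul_sum]
    refine Finset.sum_nonneg fun a _ => Finset.sum_nonneg fun b _ => ?_
    by_cases hab : a = b
    · subst hab
      rw [Pi.add_apply, mul_left_comm, h_diag, mul_zero]
    · exact mul_nonneg (hy0 a) (mul_nonneg (hoff a b hab) (hvy b))
  have h_le : y ⬝ᵥ M *ᵥ v ≤ 0 :=
    Finset.sum_nonpos fun a _ => mul_nonpos_of_nonneg_of_nonpos (hy0 a) (hv a)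
  rw [mulVec_add, dotProduct_add] at h_sum
  have hy_zero : y = 0 := by
    by_contra h
    linarith [hneg y h]
  simpa [hy_zero] using hvy k

/-- For a symmetric integer matrix whose real cast is negative definite and whose
off-diagonal entries are nonnegative (an intersection matrix of exceptional divisors),
for any two indices `i ≠ j` there is an effective cycle `m` with `M·m ≤ 0` and `m i ≠ m j`. -/
theorem exists_cycle_ne_coords
    (n : ℕ) (hn : 2 ≤ n) (M : Matrix (Fin n) (Fin n) ℤ) (hsym : M.IsSymm)
    (hneg : ∀ x : Fin n → ℝ, x ≠ 0 → x ⬝ᵥ (M.map (Int.cast : ℤ → ℝ)).mulVec x < 0)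
    (hoff : ∀ i j : Fin n, i ≠ j → 0 ≤ M i j) :
    ∀ i j : Fin n, i ≠ j →
      ∃ m : Fin n → ℤ, (∀ k, 0 ≤ m k) ∧ (∀ k, M.mulVec m k ≤ 0) ∧ m i ≠ m j := by
  intro i j hij
  have hneg_int : ∀ x : Fin n → ℤ, x ≠ 0 → x ⬝ᵥ M *ᵥ x < 0 := by
    intro x hx
    have h := hneg (fun k => (x k : ℝ)) fun h => hx <| funext fun k => by
      simpa using congrFun h k
    simp only [dotProduct, mulVec, map_apply] at h ⊢
    exact_mod_cast h
  have hdet : M.det ≠ 0 := by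
    intro h
    obtain ⟨x, hx, hMx⟩ := exists_mulVec_eq_zero_iff.mpr h
    simpa [hMx] using hneg_int x hx
  obtain ⟨k, hk⟩ : ∃ k, M.adjugate i k ≠ M.adjugate j k := by
    by_contra! h
    have h_eq : (M.adjugate * M) i i = (M.adjugate * M) j i := by
      simp only [mul_apply, h]
    rw [adjugate_mul] at h_eq
    simp [hij.symm, hdet] at h_eq
  have hM : ∀ l, (M *ᵥ (M.adjugate *ᵥ Pi.single k (-M.det))) l ≤ 0 := by
    intro l
    rw [mulVec_mulVec, mul_adjugate, smul_mulVec, one_mulVec, Pi.smul_apply, smul_eq_mul]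
    by_cases hl : l = k
    · subst hl
      simpa using mul_self_nonneg M.det
    · simp [hl]
  exact ⟨_, nonneg_of_mulVec_nonpos_s8 hneg_int hoff hM, hM, by simpa [hdet] using hk⟩
end

section
/- Let M be a symmetric n×n real matrix which is negative definite and whose off-diagonal entries are nonnegative (M i j ≥ 0 for i ≠ j). If a vector m ∈ ℝⁿ satisfies (M·m) k ≤ 0 for every k, then m k ≥ 0 for every k. -/
open Matrix

/-- If the off-diagonal entries of `M` are nonnegative, so is the pairing through `M` of the
negative and positive parts of a vector, which have disjoint supports. -/
theorem negPart_dotProduct_mulVec_posPart_nonneg {ι : Type*} [Fintype ι] {M : Matrix ι ι ℝ}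
    (hoff : ∀ i j, i ≠ j → 0 ≤ M i j) (v : ι → ℝ) : 0 ≤ v⁻ ⬝ᵥ M *ᵥ v⁺ := by
  refine Finset.sum_nonneg fun i _ => ?_
  rw [mulVec, dotProduct, Finset.mul_sum]
  refine Finset.sum_nonneg fun j _ => ?_
  obtain rfl | hij := eq_or_ne i j
  · rcases le_total 0 (v i) with h | h <;> simp [h]
  · exact mul_nonneg (negPart_nonneg v i)
      (mul_nonneg (hoff i j hij) (posPart_nonneg v j))

/-- For a symmetric negative definite real matrix with nonnegative off-diagonal entries
(an intersection matrix of exceptional divisors), any vector `m` with `M·m ≤ 0`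
componentwise is itself nonnegative componentwise: cycles `B` with `B·E_k ≤ 0` for all `k`
are effective. -/
theorem nonneg_of_mulVec_nonpos
    (n : ℕ) (M : Matrix (Fin n) (Fin n) ℝ) (hsym : M.IsSymm)
    (hneg : ∀ x : Fin n → ℝ, x ≠ 0 → x ⬝ᵥ M.mulVec x < 0)
    (hoff : ∀ i j : Fin n, i ≠ j → 0 ≤ M i j)
    (m : Fin n → ℝ) (hm : ∀ k, M.mulVec m k ≤ 0) :
    ∀ k, 0 ≤ m k := by
  have hpos := negPart_dotProduct_mulVec_posPart_nonneg hoff m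
  have hle : m⁻ ⬝ᵥ M *ᵥ m ≤ 0 :=
    Finset.sum_nonpos fun k _ => mul_nonpos_of_nonneg_of_nonpos (negPart_nonneg m k) (hm k)
  have hsplit : m⁻ ⬝ᵥ M *ᵥ m = m⁻ ⬝ᵥ M *ᵥ m⁺ - m⁻ ⬝ᵥ M *ᵥ m⁻ := by
    rw [← dotProduct_sub, ← mulVec_sub, posPart_sub_negPart]
  have hzero : m⁻ = 0 := by
    by_contra h
    linarith [hneg _ h]
  exact negPart_eq_zero.mp hzero
end
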